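/- Let H be a subgroup of a finite group G. If ⟨Ind_H^G ψ, Ind_H^G ψ'⟩_G > 0 for all ψ, ψ' ∈ Irr(H) (i.e., the matrix S = M Mᵀ is strictly positive), then H is a depth three subgroup of G; that is, there exists a positive integer n such that ⟨Res_H(Ind_H^G(Res_H(Ind_H^G ψ))), ψ'⟩_H ≤ n · ⟨Res_H(Ind_H^G ψ), ψ'⟩_H for all ψ, ψ' ∈ Irr(H). -/

import Mathlib

open scoped BigOperators Classical ComplexOrder

noncomputable def innerProd (K : Type) [Group K] [Fintype K] (φ φ' : K → ℂ) : ℂ :=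
  (Fintype.card K : ℂ)⁻¹ * ∑ k : K, φ k * (starRingEnd ℂ) (φ' k)

noncomputable def ind {G : Type} [Group G] [Fintype G] (H : Subgroup G) (ψ : H → ℂ) :
    G → ℂ :=
  fun g => (Fintype.card H : ℂ)⁻¹ *
    ∑ x : G, if h : x⁻¹ * g * x ∈ H then ψ ⟨x⁻¹ * g * x, h⟩ else 0

def res {G : Type} [Group G] (H : Subgroup G) (φ : G → ℂ) : H → ℂ :=
  fun h => φ (h : G)

def IsIrrChar (K : Type) [Group K] [Fintype K] (ψ : K → ℂ) : Prop :=
  ∃ V : FDRep ℂ K, CategoryTheory.Simple V ∧ ψ = V.character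

lemma char_inv_conj {K : Type} [Group K] [Fintype K] (V : FDRep ℂ K) (g : K) :
    V.character g⁻¹ = (starRingEnd ℂ) (V.character g) := by
  let b := Module.finBasis ℂ V
  let M : K → Matrix _ _ ℂ := fun g => LinearMap.toMatrix b b (V.ρ g)
  have hmul : ∀ x y, M (x * y) = M x * M y := by
    intro x y
    simp only [M, map_mul]
    exact LinearMap.toMatrix_mul b _ _
  have hone : M 1 = 1 := by
    simp only [M, map_one]
    exact LinearMap.toMatrix_one b
  have hch : ∀ x, V.character x = (M x).trace := fun x =>
    LinearMap.trace_eq_matrix_trace ℂ b _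
  let P := ∑ x : K, (M x).conjTranspose * M x
  have hP : P.PosDef := by
    have h1 : P = (M 1).conjTranspose * M 1
        + ∑ x ∈ Finset.univ.erase 1, (M x).conjTranspose * M x :=
      (Finset.add_sum_erase _ _ (Finset.mem_univ _)).symm
    rw [h1, hone]
    apply Matrix.PosDef.add_posSemidef
    · simpa using Matrix.PosDef.one
    · exact Matrix.posSemidef_sum _ fun x _ => Matrix.posSemidef_conjTranspose_mul_self _
  have hinv : (M g).conjTranspose * P * M g = P := by
    simp only [P, Finset.mul_sum, Finset.sum_mul]
    refine Fintype.sum_equiv (Equiv.mulRight g) _ _ fun x => ?_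
    simp only [Equiv.coe_mulRight, hmul, Matrix.conjTranspose_mul, Matrix.mul_assoc]
  have hgg : M g * M g⁻¹ = 1 := by rw [← hmul, mul_inv_cancel, hone]
  have hu : IsUnit P.det := (Matrix.isUnit_iff_isUnit_det _).1 hP.isUnit
  have h2 : (M g).conjTranspose * P = P * M g⁻¹ := by
    calc (M g).conjTranspose * P = (M g).conjTranspose * P * (M g * M g⁻¹) := by
          rw [hgg, Matrix.mul_one]
      _ = ((M g).conjTranspose * P * M g) * M g⁻¹ := by simp only [Matrix.mul_assoc]
      _ = _ := by rw [hinv]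
  have h3 : (M g).conjTranspose = P * M g⁻¹ * P⁻¹ := by
    rw [← h2, Matrix.mul_assoc, Matrix.mul_nonsing_inv _ hu, Matrix.mul_one]
  have h4 : (M g).conjTranspose.trace = (M g⁻¹).trace := by
    rw [h3, Matrix.trace_mul_comm, ← Matrix.mul_assoc, Matrix.nonsing_inv_mul _ hu,
      Matrix.one_mul]
  rw [hch, hch, ← h4, Matrix.trace_conjTranspose]
  rfl

lemma finite_irr (K : Type) [Group K] [Fintype K] : {ψ : K → ℂ | IsIrrChar K ψ}.Finite := by
  have hinv : Invertible (Nat.card K : ℂ) := invertibleOfNonzero (by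
    exact_mod_cast Nat.card_pos.ne')
  have horth : ∀ ψ ψ' : K → ℂ, IsIrrChar K ψ → IsIrrChar K ψ' →
      (ψ ≠ ψ' → ∑ g, ψ g * ψ' g⁻¹ = 0) ∧ (ψ = ψ' → ∑ g, ψ g * ψ' g⁻¹ ≠ 0) := by
    rintro ψ ψ' ⟨V, hV, rfl⟩ ⟨W, hW, rfl⟩
    have h := FDRep.char_orthonormal V W
    constructor
    · intro hne
      rw [if_neg (fun ⟨i⟩ => hne (FDRep.char_iso i))] at h
      exact (mul_eq_zero.1 h).resolve_left (inv_ne_zero hinv.ne_zero)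
    · intro he h0
      have h' := FDRep.char_orthonormal V V
      rw [if_pos ⟨CategoryTheory.Iso.refl V⟩] at h'
      rw [← he] at h0
      rw [h0] at h'
      simp at h'
  have hli : LinearIndependent ℂ (fun ψ : {ψ : K → ℂ | IsIrrChar K ψ} => (ψ : K → ℂ)) := by
    rw [linearIndependent_iff']
    intro s c hc i hi
    have h0 : ∑ g, (∑ j ∈ s, c j • (j : K → ℂ)) g * (i : K → ℂ) g⁻¹ = 0 := by
      rw [hc]; simp
    have h1 : ∑ g, (∑ j ∈ s, c j • (j : K → ℂ)) g * (i : K → ℂ) g⁻¹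
        = ∑ j ∈ s, c j * ∑ g, (j : K → ℂ) g * (i : K → ℂ) g⁻¹ := by
      simp only [Finset.sum_apply, Pi.smul_apply, smul_eq_mul, Finset.sum_mul, Finset.mul_sum]
      rw [Finset.sum_comm]
      simp only [mul_assoc]
    rw [h1, Finset.sum_eq_single_of_mem i hi] at h0
    · exact (mul_eq_zero.1 h0).resolve_right ((horth _ _ i.2 i.2).2 rfl)
    · intro j _ hj
      rw [(horth _ _ j.2 i.2).1 (fun h => hj (Subtype.ext h)), mul_zero]
  exact hli.setFinite

lemma ind_class {G : Type} [Group G] [Fintype G] (H : Subgroup G) (ψ : H → ℂ) (y g : G) :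
    ind H ψ (y * g * y⁻¹) = ind H ψ g := by
  unfold ind
  congr 1
  refine Fintype.sum_equiv (Equiv.mulLeft y⁻¹) _ _ fun x => ?_
  have : x⁻¹ * (y * g * y⁻¹) * x = (y⁻¹ * x)⁻¹ * g * (y⁻¹ * x) := by group
  exact congrArg (fun k : G => if h : k ∈ H then ψ ⟨k, h⟩ else 0) this

lemma ind_inv {G : Type} [Group G] [Fintype G] (H : Subgroup G) (ψ : H → ℂ)
    (hψ : ∀ h, ψ h⁻¹ = (starRingEnd ℂ) (ψ h)) (g : G) :
    ind H ψ g⁻¹ = (starRingEnd ℂ) (ind H ψ g) := by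
  unfold ind
  rw [map_mul, map_inv₀, map_natCast, map_sum]
  congr 1
  refine Finset.sum_congr rfl fun x _ => ?_
  have e : x⁻¹ * g⁻¹ * x = (x⁻¹ * g * x)⁻¹ := by group
  by_cases h : x⁻¹ * g * x ∈ H
  · have h' : x⁻¹ * g⁻¹ * x ∈ H := by rw [e]; exact H.inv_mem h
    rw [dif_pos h, dif_pos h', ← hψ]
    congr 1
    exact Subtype.ext e
  · have h' : ¬ x⁻¹ * g⁻¹ * x ∈ H := by rw [e]; exact fun h' => h (H.inv_mem_iff.1 h')
    rw [dif_neg h, dif_neg h', map_zero]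

lemma frobenius_recip {G : Type} [Group G] [Fintype G] (H : Subgroup G) (φ : G → ℂ)
    (hφ : ∀ y g, φ (y * g * y⁻¹) = φ g) (ψ : H → ℂ) :
    innerProd G φ (ind H ψ) = innerProd H (res H φ) ψ := by
  let f : G → ℂ := fun k => if h : k ∈ H then (starRingEnd ℂ) (ψ ⟨k, h⟩) else 0
  have h1 : ∀ g, (starRingEnd ℂ) (ind H ψ g)
      = (Fintype.card H : ℂ)⁻¹ * ∑ x : G, f (x⁻¹ * g * x) := by
    intro g
    unfold ind
    rw [map_mul, map_inv₀, map_natCast, map_sum]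
    congr 1
    refine Finset.sum_congr rfl fun x _ => ?_
    simp only [f]
    split_ifs <;> simp
  have h2 : ∀ x : G, ∑ g, φ g * f (x⁻¹ * g * x) = ∑ k, φ k * f k := by
    intro x
    refine Fintype.sum_equiv (MulAut.conj x⁻¹).toEquiv _ _ fun g => ?_
    have h := hφ x⁻¹ g
    simp only [inv_inv] at h
    simp [h]
  have h3 : ∑ k, φ k * f k = ∑ k : H, res H φ k * (starRingEnd ℂ) (ψ k) := by
    have : ∑ k ∈ Finset.univ.filter (· ∈ H), φ k * f k = ∑ k, φ k * f k := by
      apply Finset.sum_filter_of_ne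
      intro k _ hk
      by_contra hn
      simp [f, hn] at hk
    rw [← this, Finset.sum_subtype (p := (· ∈ H)) _ (by simp)]
    refine Finset.sum_congr rfl fun k _ => ?_
    simp [f, res]
  have hG : (Fintype.card G : ℂ) ≠ 0 := by exact_mod_cast Fintype.card_ne_zero
  unfold innerProd
  simp only [h1, ← h3]
  have h4 : ∑ g, φ g * ((Fintype.card H : ℂ)⁻¹ * ∑ x : G, f (x⁻¹ * g * x))
      = (Fintype.card H : ℂ)⁻¹ * ∑ x : G, ∑ g, φ g * f (x⁻¹ * g * x) := by
    rw [Finset.sum_comm, Finset.mul_sum]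
    refine Finset.sum_congr rfl fun g _ => ?_
    rw [← Finset.mul_sum]; ring
  rw [h4]
  simp only [h2, Finset.sum_const, Finset.card_univ, nsmul_eq_mul]
  field_simp

lemma innerProd_real {K : Type} [Group K] [Fintype K] (φ φ' : K → ℂ)
    (h : ∀ g, φ g⁻¹ = (starRingEnd ℂ) (φ g)) (h' : ∀ g, φ' g⁻¹ = (starRingEnd ℂ) (φ' g)) :
    (innerProd K φ φ').im = 0 := by
  rw [← Complex.conj_eq_iff_im]
  unfold innerProd
  rw [map_mul, map_inv₀, map_natCast, map_sum]
  congr 1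
  refine Fintype.sum_equiv (Equiv.inv K) _ _ fun x => ?_
  simp [h, h']

/-- If `⟨Ind_H^G ψ, Ind_H^G ψ'⟩_G > 0` for all irreducible characters `ψ, ψ'` of `H`
(i.e. `S = M Mᵀ` is strictly positive), then `H` is a depth three subgroup of `G`. -/
theorem depth_three_of_strictly_positive {G : Type} [Group G] [Fintype G] (H : Subgroup G)
    (hpos : ∀ ψ ψ' : H → ℂ, IsIrrChar H ψ → IsIrrChar H ψ' →
      0 < innerProd G (ind H ψ) (ind H ψ')) :
    ∃ n : ℕ, 0 < n ∧ ∀ ψ ψ' : H → ℂ, IsIrrChar H ψ → IsIrrChar H ψ' →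
      innerProd H (res H (ind H (res H (ind H ψ)))) ψ'
        ≤ (n : ℂ) * innerProd H (res H (ind H ψ)) ψ' := by
  have hfin := (finite_irr H).prod (finite_irr H)
  obtain ⟨B, hB⟩ := (hfin.image (fun p : (H → ℂ) × (H → ℂ) =>
    (innerProd H (res H (ind H (res H (ind H p.1)))) p.2).re /
      (innerProd H (res H (ind H p.1)) p.2).re)).bddAbove
  obtain ⟨n, hn⟩ := exists_nat_ge B
  refine ⟨n + 1, n.succ_pos, fun ψ ψ' h h' => ?_⟩
  have hle := hB ⟨(ψ, ψ'), ⟨h, h'⟩, rfl⟩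
  have hp := hpos ψ ψ' h h'
  rw [frobenius_recip H _ (ind_class H ψ)] at hp
  have hr : ∀ χ, IsIrrChar H χ → ∀ g, χ g⁻¹ = (starRingEnd ℂ) (χ g) := by
    rintro _ ⟨V, _, rfl⟩ g
    exact char_inv_conj V g
  have him := innerProd_real (res H (ind H (res H (ind H ψ)))) ψ'
    (fun g => ind_inv H _ (fun k => ind_inv H ψ (hr ψ h) k) g) (hr ψ' h')
  rw [Complex.pos_iff] at hp
  simp only at hle
  rw [div_le_iff₀ hp.1] at hle
  rw [Complex.le_def]
  have e : (((n + 1 : ℕ) : ℂ)) = (((n + 1 : ℝ)) : ℂ) := by push_cast; rfl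
  rw [e, Complex.re_ofReal_mul, Complex.im_ofReal_mul, him, ← hp.2]
  refine ⟨hle.trans ?_, by simp⟩
  exact mul_le_mul_of_nonneg_right (by linarith) hp.1.le
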